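/- Let q ∈ k be a primitive ℓth root of unity with ℓ ≥ 2 and ℓ ≠ 3, and let H_q be the quantum Heisenberg algebra. If 3 does not divide ℓ, then the ozone group Oz(H_q) is isomorphic to the cyclic group ℤ/ℓ. If 3 divides ℓ, then Oz(H_q) is isomorphic to ℤ/ℓ × ℤ/3. -/

import Mathlib

noncomputable section

/-- The **ozone group** of a `k`-algebra `A`: the group of `k`-algebra automorphisms
of `A` that fix the center of `A` pointwise. -/
def ozoneGroup (k A : Type*) [CommSemiring k] [Semiring A] [Algebra k A] :
    Subgroup (A ≃ₐ[k] A) where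
  carrier := {σ | ∀ z ∈ Subalgebra.center k A, σ z = z}
  one_mem' := fun _ _ => rfl
  mul_mem' := by
    intro σ τ hσ hτ z hz
    show σ (τ z) = z
    rw [hτ z hz, hσ z hz]
  inv_mem' := by
    intro σ hσ z hz
    show σ.symm z = z
    conv_lhs => rw [← hσ z hz]
    exact σ.symm_apply_apply z

/-- An element `a` of a ring is **normal** if `a·A = A·a`. -/
def IsNormal {A : Type*} [Mul A] (a : A) : Prop :=
  Set.range (fun x => a * x) = Set.range (fun x => x * a)

/-- The defining relations of the quantum Heisenberg algebra `H_q`: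
`zx = q·xz`, `yz = q·zy`, and `xy = q·yx + z²` (generators `x = ι 0`, `y = ι 1`, `z = ι 2`). -/
inductive HeisRel (k : Type*) [Field k] (q : k) :
    FreeAlgebra k (Fin 3) → FreeAlgebra k (Fin 3) → Prop
  | zx : HeisRel k q (FreeAlgebra.ι k 2 * FreeAlgebra.ι k 0)
      (q • (FreeAlgebra.ι k 0 * FreeAlgebra.ι k 2))
  | yz : HeisRel k q (FreeAlgebra.ι k 1 * FreeAlgebra.ι k 2)
      (q • (FreeAlgebra.ι k 2 * FreeAlgebra.ι k 1))
  | xy : HeisRel k q (FreeAlgebra.ι k 0 * FreeAlgebra.ι k 1)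
      (q • (FreeAlgebra.ι k 1 * FreeAlgebra.ι k 0) + FreeAlgebra.ι k 2 ^ 2)

/-- The quantum Heisenberg algebra `H_q = k⟨x,y,z⟩/(zx − qxz, yz − qzy, xy − qyx − z²)`. -/
abbrev Heis (k : Type*) [Field k] (q : k) := RingQuot (HeisRel k q)

/-! ### The quantum torus, acting on Laurent polynomials -/

namespace HeisAux

abbrev Gam := ℤ × ℤ × ℤ

section torus

set_option linter.unusedSectionVars false

variable {k : Type*} [Field k] (q : k)

/-- The bicharacter of the quantum torus. -/
def tB (p r : Gam) : k := q ^ ((p.2.2 - p.2.1) * r.1)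

variable {q}

lemma tB_ne (hq : q ≠ 0) (p r : Gam) : tB q p r ≠ 0 := zpow_ne_zero _ hq

lemma tB_zero_right (p : Gam) : tB q p 0 = 1 := by simp [tB]

lemma tB_zero_left (p : Gam) : tB q 0 p = 1 := by simp [tB]

variable (q)

/-- The monomial operator. -/
def tM (p : Gam) : Module.End k (Gam →₀ k) :=
  Finsupp.linearCombination k (fun r => Finsupp.single (p + r) (tB q p r))

/-- The left multiplication operator of the quantum torus. -/
def tL : (Gam →₀ k) →ₗ[k] Module.End k (Gam →₀ k) :=
  Finsupp.linearCombination k (tM q)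

variable {q}

lemma tM_single (p r : Gam) (c : k) :
    tM q p (Finsupp.single r c) = Finsupp.single (p + r) (c * tB q p r) := by
  simp [tM]

lemma tM_mul (hq : q ≠ 0) (p r : Gam) : tM q p * tM q r = tB q p r • tM q (p + r) := by
  refine Finsupp.lhom_ext fun s c => ?_
  simp only [Module.End.mul_apply, LinearMap.smul_apply, tM_single, Finsupp.smul_single, add_assoc]
  congr 1
  simp only [tB, smul_eq_mul, Prod.fst_add, Prod.snd_add]
  have : q ^ ((p.2.2 + r.2.2 - (p.2.1 + r.2.1)) * s.1) =
      q ^ ((p.2.2 - p.2.1) * s.1) * q ^ ((r.2.2 - r.2.1) * s.1) := by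
    rw [← zpow_add₀ hq]; congr 1; ring
  rw [this, mul_add, zpow_add₀ hq]
  ring

lemma tM_zero : tM q 0 = 1 := by
  refine Finsupp.lhom_ext fun s c => ?_
  simp [tM_single, tB_zero_left]

lemma tL_single (p : Gam) (c : k) : tL q (Finsupp.single p c) = c • tM q p := by
  simp [tL]

lemma tL_mul (hq : q ≠ 0) (f g : Gam →₀ k) : tL q f * tL q g = tL q (tL q f g) := by
  induction f using Finsupp.induction_linear with
  | zero => simp
  | add f1 f2 h1 h2 => simp [add_mul, h1, h2]
  | single p a =>
    induction g using Finsupp.induction_linear with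
    | zero => simp
    | add f1 f2 h1 h2 => rw [map_add, mul_add, h1, h2, map_add, map_add]
    | single r b =>
      rw [tL_single, tL_single, LinearMap.smul_apply, tM_single, map_smul, tL_single,
        smul_mul_smul_comm, tM_mul hq, smul_smul, smul_smul, mul_assoc]

lemma tL_one (f : Gam →₀ k) : tL q f (Finsupp.single 0 1) = f := by
  induction f using Finsupp.induction_linear with
  | zero => simp
  | add f1 f2 h1 h2 => simp [h1, h2]
  | single p a => simp [tL_single, tM_single, tB_zero_right]

lemma tL_apply (f g : Gam →₀ k) (t : Gam) :
    tL q f g t = ∑ p ∈ f.support, ∑ r ∈ g.support,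
      if p + r = t then f p * (g r * tB q p r) else 0 := by
  simp only [tL, tM, Finsupp.linearCombination_apply, Finsupp.sum, LinearMap.sum_apply,
    LinearMap.smul_apply, Finsupp.finsetSum_apply, Finsupp.smul_apply, smul_eq_mul,
    Finset.mul_sum, Finsupp.single_apply]
  refine Finset.sum_congr rfl fun p _ => Finset.sum_congr rfl fun r _ => ?_
  split_ifs <;> simp

variable {Λ : Type*} [AddCommGroup Λ] [LinearOrder Λ] [IsOrderedAddMonoid Λ]

/-- `f` has its leading exponent at `p`. -/
def HasTop (u : Gam →+ Λ) (f : Gam →₀ k) (p : Gam) : Prop :=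
  f p ≠ 0 ∧ ∀ r, f r ≠ 0 → u r ≤ u p

lemma HasTop.mul (hq : q ≠ 0) {u : Gam →+ Λ} (hu : Function.Injective u) {f g : Gam →₀ k}
    {p r : Gam} (hf : HasTop u f p) (hg : HasTop u g r) : HasTop u (tL q f g) (p + r) := by
  constructor
  · have key : ∀ p' ∈ f.support, ∀ r' ∈ g.support, p' + r' = p + r → p' = p ∧ r' = r := by
      intro p' hp' r' hr' h
      have h1 := hf.2 p' (by simpa using hp')
      have h2 := hg.2 r' (by simpa using hr')
      have h3 : u p' + u r' = u p + u r := by rw [← map_add, h, map_add]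
      have h4 : u p' = u p := by
        apply le_antisymm h1
        by_contra hlt
        push Not at hlt
        exact absurd h3 (add_lt_add_of_lt_of_le hlt h2).ne
      have h5 : p' = p := hu h4
      subst h5
      exact ⟨rfl, add_left_cancel h⟩
    rw [tL_apply, Finset.sum_eq_single p, Finset.sum_eq_single r]
    · rw [if_pos rfl]
      exact mul_ne_zero hf.1 (mul_ne_zero hg.1 (tB_ne hq _ _))
    · intro r' hr' hne
      rw [if_neg]
      intro h
      exact hne (key p (by simpa using hf.1) r' hr' h).2
    · intro h; exact absurd hg.1 (by simpa using h)
    · intro p' hp' hne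
      refine Finset.sum_eq_zero fun r' hr' => ?_
      rw [if_neg]
      intro h
      exact hne (key p' hp' r' hr' h).1
    · intro h; exact absurd hf.1 (by simpa using h)
  · intro t ht
    rw [tL_apply] at ht
    obtain ⟨p', hp', h⟩ := Finset.exists_ne_zero_of_sum_ne_zero ht
    obtain ⟨r', hr', h⟩ := Finset.exists_ne_zero_of_sum_ne_zero h
    have : p' + r' = t := by
      by_contra hh
      exact h (if_neg hh)
    rw [← this, map_add, map_add]
    exact add_le_add (hf.2 p' (by simpa using hp')) (hg.2 r' (by simpa using hr'))

lemma HasTop.unique {u : Gam →+ Λ} (hu : Function.Injective u) {f : Gam →₀ k} {p r : Gam}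
    (hf : HasTop u f p) (hg : HasTop u f r) : p = r :=
  hu (le_antisymm (hg.2 _ hf.1) (hf.2 _ hg.1))

lemma exists_hasTop (u : Gam →+ Λ) {f : Gam →₀ k} (hf : f ≠ 0) : ∃ p, HasTop u f p := by
  obtain ⟨p, hp, h⟩ := Finset.exists_max_image f.support u (by simpa using hf)
  exact ⟨p, by simpa using hp, fun r hr => h r (by simpa using hr)⟩

lemma hasTop_single (u : Gam →+ Λ) (p : Gam) {c : k} (hc : c ≠ 0) :
    HasTop u (Finsupp.single p c) p := by
  refine ⟨by simpa using hc, fun r hr => ?_⟩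
  rw [Finsupp.single_apply] at hr
  split_ifs at hr with h
  · rw [h]
  · exact absurd rfl hr

lemma HasTop.pow (hq : q ≠ 0) {u : Gam →+ Λ} (hu : Function.Injective u) {f : Gam →₀ k}
    {p : Gam} (hf : HasTop u f p) (n : ℕ) :
    HasTop u ((tL q f ^ n) (Finsupp.single 0 1)) (n • p) := by
  induction n with
  | zero => simpa using hasTop_single u 0 one_ne_zero
  | succ n ih =>
    rw [pow_succ', Module.End.mul_apply, succ_nsmul']
    exact hf.mul hq hu ih

lemma HasTop.pow_apply (hq : q ≠ 0) {u : Gam →+ Λ} (hu : Function.Injective u) {f g : Gam →₀ k}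
    {p r : Gam} (hf : HasTop u f p) (hg : HasTop u g r) (n : ℕ) :
    HasTop u ((tL q f ^ n) g) (n • p + r) := by
  induction n with
  | zero => simpa using hg
  | succ n ih =>
    rw [pow_succ', Module.End.mul_apply, succ_nsmul', add_assoc]
    exact hf.mul hq hu ih

/-- The lexicographic weight on exponents. -/
def wt : Gam →+ ℤ ×ₗ ℤ ×ₗ ℤ where
  toFun p := toLex (p.2.1, toLex (p.1, p.2.2))
  map_zero' := rfl
  map_add' _ _ := rfl

lemma wt_inj : Function.Injective wt := by
  rintro ⟨a, b, c⟩ ⟨a', b', c'⟩ h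
  change toLex (b, toLex (a, c)) = toLex (b', toLex (a', c')) at h
  simp only [EmbeddingLike.apply_eq_iff_eq, Prod.mk.injEq] at h
  simp [h]

lemma neg_wt_inj : Function.Injective (-wt) := by
  intro a b h
  exact wt_inj (neg_injective h)

/-- An `n`-th root of (the `n`-th power of) a monomial is a multiple of the monomial. -/
lemma root_of_monomial (hq : q ≠ 0) {f : Gam →₀ k} {p : Gam} {n : ℕ} (hn : n ≠ 0)
    (h : tL q f ^ n = tM q p ^ n) : f = Finsupp.single p (f p) := by
  have hM : tM q p = tL q (Finsupp.single p 1) := by simp [tL_single]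
  have hf : f ≠ 0 := by
    rintro rfl
    have h1 := (hasTop_single wt p (one_ne_zero (α := k))).pow hq wt_inj n
    rw [← hM, ← h, map_zero, zero_pow hn] at h1
    exact h1.1 rfl
  have aux : ∀ u : Gam →+ ℤ ×ₗ ℤ ×ₗ ℤ, Function.Injective u → HasTop u f p := by
    intro u hu
    obtain ⟨r, hr⟩ := exists_hasTop u hf
    have h1 := (hasTop_single u p (one_ne_zero (α := k))).pow hq hu n
    have h2 := hr.pow hq hu n
    rw [← hM, ← h] at h1
    have h3 := h2.unique hu h1
    have h4 : r = p := nsmul_right_injective hn h3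
    exact h4 ▸ hr
  have h1 := aux wt wt_inj
  have h2 := aux (-wt) neg_wt_inj
  ext r
  rw [Finsupp.single_apply]
  split_ifs with hr
  · rw [hr]
  · by_contra hne
    have h3 := h1.2 r hne
    have h4 := h2.2 r hne
    simp only [AddMonoidHom.neg_apply, neg_le_neg_iff] at h4
    exact hr (wt_inj (le_antisymm h4 h3))

lemma tL_comm (hq : q ≠ 0) {p : Gam} (h : ∀ r, tB q p r = tB q r p) (f : Gam →₀ k) :
    tL q f * tM q p = tM q p * tL q f := by
  induction f using Finsupp.induction_linear with
  | zero => simp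
  | add f1 f2 h1 h2 => simp [add_mul, mul_add, h1, h2]
  | single r b =>
    rw [tL_single, smul_mul_assoc, mul_smul_comm, tM_mul hq, tM_mul hq, h, add_comm]

end torus
section heis

variable {k : Type*} [Field k] (q : k)

/-- The generators of `H_q`. -/
def gen (i : Fin 3) : Heis k q := RingQuot.mkAlgHom k (HeisRel k q) (FreeAlgebra.ι k i)

lemma rel_zx : gen q 2 * gen q 0 = q • (gen q 0 * gen q 2) := by
  have h := RingQuot.mkAlgHom_rel k (HeisRel.zx (k := k) (q := q))
  simp only [map_mul, map_smul] at h
  exact h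

lemma rel_yz : gen q 1 * gen q 2 = q • (gen q 2 * gen q 1) := by
  have h := RingQuot.mkAlgHom_rel k (HeisRel.yz (k := k) (q := q))
  simp only [map_mul, map_smul] at h
  exact h

lemma rel_xy : gen q 0 * gen q 1 = q • (gen q 1 * gen q 0) + gen q 2 ^ 2 := by
  have h := RingQuot.mkAlgHom_rel k (HeisRel.xy (k := k) (q := q))
  simp only [map_mul, map_smul, map_add, map_pow] at h
  exact h

section lift

variable {B : Type*} [Ring B] [Algebra k B]

/-- The universal property of `H_q`. -/
def heisLift (x y z : B) (hzx : z * x = q • (x * z)) (hyz : y * z = q • (z * y))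
    (hxy : x * y = q • (y * x) + z ^ 2) : Heis k q →ₐ[k] B :=
  RingQuot.liftAlgHom k ⟨FreeAlgebra.lift k ![x, y, z], by
    intro a b h
    cases h <;> simp [hzx, hyz, hxy]⟩

variable {x y z : B} {hzx : z * x = q • (x * z)} {hyz : y * z = q • (z * y)}
    {hxy : x * y = q • (y * x) + z ^ 2}

lemma heisLift_gen (i : Fin 3) : heisLift q x y z hzx hyz hxy (gen q i) = ![x, y, z] i := by
  rw [heisLift, gen, RingQuot.liftAlgHom_mkAlgHom_apply, FreeAlgebra.lift_ι_apply]

lemma heisLift_x : heisLift q x y z hzx hyz hxy (gen q 0) = x := heisLift_gen q 0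

lemma heisLift_y : heisLift q x y z hzx hyz hxy (gen q 1) = y := heisLift_gen q 1

lemma heisLift_z : heisLift q x y z hzx hyz hxy (gen q 2) = z := heisLift_gen q 2

variable {q}

lemma heis_ext {f g : Heis k q →ₐ[k] B} (h0 : f (gen q 0) = g (gen q 0))
    (h1 : f (gen q 1) = g (gen q 1)) (h2 : f (gen q 2) = g (gen q 2)) : f = g := by
  apply RingQuot.ringQuot_ext'
  apply FreeAlgebra.hom_ext
  funext i
  fin_cases i
  · exact h0
  · exact h1
  · exact h2

end lift

variable {q}

lemma heis_induction {P : Heis k q → Prop} (hc : ∀ c : k, P (algebraMap k _ c))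
    (hg : ∀ i, P (gen q i)) (hm : ∀ a b, P a → P b → P (a * b))
    (ha : ∀ a b, P a → P b → P (a + b)) (h : Heis k q) : P h := by
  obtain ⟨t, rfl⟩ := RingQuot.mkAlgHom_surjective k (HeisRel k q) h
  induction t using FreeAlgebra.induction with
  | grade0 r => rw [AlgHom.commutes]; exact hc r
  | grade1 i => exact hg i
  | mul a b h1 h2 => rw [map_mul]; exact hm _ _ h1 h2
  | add a b h1 h2 => rw [map_add]; exact ha _ _ h1 h2

/-- PBW monomials. -/
def mono (q : k) (i : ℕ × ℕ × ℕ) : Heis k q := gen q 1 ^ i.1 * gen q 0 ^ i.2.1 * gen q 2 ^ i.2.2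

lemma rel_zy (hq : q ≠ 0) : gen q 2 * gen q 1 = q⁻¹ • (gen q 1 * gen q 2) := by
  rw [rel_yz, smul_smul, inv_mul_cancel₀ hq, one_smul]

lemma qpow {A : Type*} [Ring A] [Algebra k A] {a b : A} {c : k} (h : a * b = c • (b * a)) (n : ℕ) :
    a * b ^ n = c ^ n • (b ^ n * a) := by
  induction n with
  | zero => simp
  | succ n ih =>
    rw [pow_succ, ← mul_assoc, ih, smul_mul_assoc, mul_assoc, h, mul_smul_comm, smul_smul,
      mul_assoc, pow_succ]

lemma mem_span_mono (hq : q ≠ 0) (h : Heis k q) : h ∈ Submodule.span k (Set.range (mono q)) := by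
  set S := Submodule.span k (Set.range (mono q)) with hS
  have hm : ∀ i, mono q i ∈ S := fun i => Submodule.subset_span ⟨i, rfl⟩
  have ext : ∀ g : Heis k q, (∀ i, g * mono q i ∈ S) → ∀ s ∈ S, g * s ∈ S := by
    intro g hg s hs
    induction hs using Submodule.span_induction with
    | mem x hx => obtain ⟨i, rfl⟩ := hx; exact hg i
    | zero => simp
    | add a b _ _ h1 h2 => rw [mul_add]; exact S.add_mem h1 h2
    | smul c a _ h1 => rw [mul_smul_comm]; exact S.smul_mem c h1
  have h1 : ∀ s ∈ S, gen q 1 * s ∈ S := by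
    apply ext
    rintro ⟨a, b, c⟩
    have := hm (a + 1, b, c)
    simpa only [mono, pow_succ', mul_assoc] using this
  have h2 : ∀ s ∈ S, gen q 2 * s ∈ S := by
    apply ext
    rintro ⟨a, b, c⟩
    have := S.smul_mem ((q⁻¹) ^ a * q ^ b) (hm (a, b, c + 1))
    convert this using 1
    simp only [mono]
    rw [← mul_assoc, ← mul_assoc, qpow (rel_zy hq), smul_mul_assoc, mul_assoc (_ ^ a),
      qpow (rel_zx q), mul_smul_comm, smul_smul, smul_mul_assoc, pow_succ']
    simp only [mul_assoc]
  have h0 : ∀ s ∈ S, gen q 0 * s ∈ S := by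
    apply ext
    rintro ⟨a, b, c⟩
    induction a with
    | zero =>
      have := hm (0, b + 1, c)
      simpa only [mono, pow_succ', mul_assoc, pow_zero, one_mul] using this
    | succ a ih =>
      have e : gen q 0 * mono q (a + 1, b, c) =
          q • (gen q 1 * (gen q 0 * mono q (a, b, c))) +
            gen q 2 * (gen q 2 * mono q (a, b, c)) := by
        have : mono q (a + 1, b, c) = gen q 1 * mono q (a, b, c) := by
          simp only [mono, pow_succ', mul_assoc]
        rw [this, ← mul_assoc, rel_xy, add_mul, smul_mul_assoc, sq, mul_assoc, mul_assoc]
      rw [e]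
      exact S.add_mem (S.smul_mem _ (h1 _ ih)) (h2 _ (h2 _ (hm _)))
  have key : ∀ g : Heis k q, ∀ s ∈ S, g * s ∈ S := by
    intro g
    induction g using heis_induction with
    | hc c =>
      intro s hs
      rw [← Algebra.smul_def]
      exact S.smul_mem _ hs
    | hg i =>
      fin_cases i
      · exact h0
      · exact h1
      · exact h2
    | hm a b ha hb =>
      intro s hs
      rw [mul_assoc]
      exact ha _ (hb _ hs)
    | ha a b ha hb =>
      intro s hs
      rw [add_mul]
      exact S.add_mem (ha _ hs) (hb _ hs)
  have h1' : (1 : Heis k q) ∈ S := by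
    have := hm (0, 0, 0)
    simpa [mono] using this
  simpa using key h 1 h1'

variable (q) in
/-- The image of `y` in the quantum torus. -/
def yf : Gam →₀ k :=
  Finsupp.single (-1, 1, 0) 1 + Finsupp.single (-1, 0, 2) (-(q ^ 3 - 1)⁻¹)

lemma tL_yf : tL q (yf q) = tM q (-1, 1, 0) + (-(q ^ 3 - 1)⁻¹) • tM q (-1, 0, 2) := by
  rw [yf, map_add, tL_single, tL_single, one_smul]

/-- The embedding of `H_q` in the quantum torus. -/
def Phi (hq : q ≠ 0) (hq3 : q ^ 3 ≠ 1) : Heis k q →ₐ[k] Module.End k (Gam →₀ k) :=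
  heisLift q (tM q (1, 0, 0)) (tL q (yf q)) (tM q (0, 0, 1))
    (by
      rw [tM_mul hq, tM_mul hq]
      simp [tB])
    (by
      rw [tL_yf, add_mul, mul_add, smul_mul_assoc, mul_smul_comm, tM_mul hq, tM_mul hq,
        tM_mul hq, tM_mul hq]
      simp [tB, smul_smul, mul_comm, hq])
    (by
      have h3 : q ^ 3 - 1 ≠ 0 := sub_ne_zero.2 hq3
      rw [tL_yf, add_mul, mul_add, smul_mul_assoc, mul_smul_comm, sq, tM_mul hq, tM_mul hq,
        tM_mul hq, tM_mul hq, tM_mul hq]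
      have e2 : -(q ^ 3 - 1)⁻¹ = q * (-(q ^ 3 - 1)⁻¹ * q ^ 2) + 1 := by field_simp; ring
      simp only [tB, smul_add, smul_smul, Prod.mk_add_mk]
      norm_num
      rw [mul_inv_cancel₀ hq, one_smul, add_assoc]
      congr 1
      have e3 : -(q ^ 3 - 1)⁻¹ = -(q * ((q ^ 3 - 1)⁻¹ * q ^ 2)) + 1 := by linear_combination e2
      conv_lhs => rw [e3, add_smul, one_smul])

variable (hq : q ≠ 0) (hq3 : q ^ 3 ≠ 1)

lemma Phi_x : Phi hq hq3 (gen q 0) = tM q (1, 0, 0) := heisLift_x q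

lemma Phi_y : Phi hq hq3 (gen q 1) = tL q (yf q) := heisLift_y q

lemma Phi_z : Phi hq hq3 (gen q 2) = tM q (0, 0, 1) := heisLift_z q

lemma tM_eq (p : Gam) : tM q p = tL q (Finsupp.single p 1) := by simp [tL_single]

lemma Phi_range (h : Heis k q) : ∃ f, Phi hq hq3 h = tL q f := by
  induction h using heis_induction with
  | hc c =>
    refine ⟨Finsupp.single 0 c, ?_⟩
    rw [AlgHom.commutes, tL_single, tM_zero, Algebra.algebraMap_eq_smul_one]
  | hg i =>
    fin_cases i
    · exact ⟨_, (Phi_x hq hq3).trans (tM_eq _)⟩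
    · exact ⟨_, Phi_y hq hq3⟩
    · exact ⟨_, (Phi_z hq hq3).trans (tM_eq _)⟩
  | hm a b ha hb =>
    obtain ⟨f, hf⟩ := ha
    obtain ⟨g, hg⟩ := hb
    exact ⟨_, by rw [map_mul, hf, hg, tL_mul hq]⟩
  | ha a b ha hb =>
    obtain ⟨f, hf⟩ := ha
    obtain ⟨g, hg⟩ := hb
    exact ⟨f + g, by rw [map_add, hf, hg, map_add]⟩

lemma hasTop_yf : HasTop wt (yf q) (-1, 1, 0) := by
  refine ⟨by simp [yf], fun r hr => ?_⟩
  by_cases h1 : r = (-1, 1, 0)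
  · rw [h1]
  by_cases h2 : r = (-1, 0, 2)
  · rw [h2]
    change toLex ((0 : ℤ), toLex ((-1 : ℤ), (2 : ℤ))) ≤ toLex ((1 : ℤ), toLex ((-1 : ℤ), (0 : ℤ)))
    rw [Prod.Lex.toLex_le_toLex]
    left
    norm_num
  · exfalso
    apply hr
    rw [yf, Finsupp.add_apply, Finsupp.single_apply, Finsupp.single_apply, if_neg (Ne.symm h1),
      if_neg (Ne.symm h2), add_zero]

/-- Leading exponents of PBW monomials. -/
def lead (i : ℕ × ℕ × ℕ) : Gam := ((i.2.1 : ℤ) - i.1, (i.1 : ℤ), (i.2.2 : ℤ))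

lemma lead_inj : Function.Injective lead := by
  rintro ⟨a, b, c⟩ ⟨a', b', c'⟩ h
  simp only [lead, Prod.mk.injEq] at h
  simp only [Prod.mk.injEq]
  omega

lemma hasTop_mono (i : ℕ × ℕ × ℕ) :
    HasTop wt (Phi hq hq3 (mono q i) (Finsupp.single 0 1)) (lead i) := by
  obtain ⟨a, b, c⟩ := i
  have h0 := hasTop_single wt (0 : Gam) (one_ne_zero (α := k))
  have h1 := (hasTop_single wt ((0, 0, 1) : Gam) (one_ne_zero (α := k))).pow_apply hq wt_inj h0 c
  have h2 := (hasTop_single wt ((1, 0, 0) : Gam) (one_ne_zero (α := k))).pow_apply hq wt_inj h1 b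
  have h3 := (hasTop_yf (q := q)).pow_apply hq wt_inj h2 a
  simp only [mono, map_mul, map_pow, Phi_x, Phi_y, Phi_z, Module.End.mul_apply, tM_eq]
  convert h3 using 1
  simp [lead]
  ring

lemma Phi_inj : Function.Injective (Phi hq hq3) := by
  rw [injective_iff_map_eq_zero]
  intro h hh
  obtain ⟨c, hc⟩ := Finsupp.mem_span_range_iff_exists_finsupp.1 (mem_span_mono hq h)
  by_cases hc0 : c = 0
  · rw [← hc, hc0]; simp
  exfalso
  obtain ⟨i, hi, hmax⟩ := Finset.exists_max_image c.support (fun i => wt (lead i))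
    (by simpa using hc0)
  have e : Phi hq hq3 h (Finsupp.single 0 1) (lead i) = 0 := by rw [hh]; rfl
  rw [← hc, Finsupp.sum, map_sum, LinearMap.sum_apply, Finsupp.finsetSum_apply,
    Finset.sum_eq_single i] at e
  · rw [map_smul, LinearMap.smul_apply, Finsupp.smul_apply, smul_eq_mul] at e
    exact mul_ne_zero (by simpa using hi) (hasTop_mono hq hq3 i).1 e
  · intro j hj hne
    rw [map_smul, LinearMap.smul_apply, Finsupp.smul_apply, smul_eq_mul]
    by_contra hcon
    have h1 := (hasTop_mono hq hq3 j).2 (lead i) (right_ne_zero_of_mul hcon)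
    exact hne (lead_inj (wt_inj (le_antisymm (hmax j hj) h1)))
  · intro hni; exact absurd hi hni


lemma heis_domain (hq : q ≠ 0) (hq3 : q ^ 3 ≠ 1) {a b : Heis k q} (h : a * b = 0) : a = 0 ∨ b = 0 := by
  by_contra! hcon
  obtain ⟨f, hf⟩ := Phi_range hq hq3 a
  obtain ⟨g, hg⟩ := Phi_range hq hq3 b
  have hf0 : f ≠ 0 := by
    rintro rfl
    exact hcon.1 (Phi_inj hq hq3 (by rw [hf, map_zero, map_zero]))
  have hg0 : g ≠ 0 := by
    rintro rfl
    exact hcon.2 (Phi_inj hq hq3 (by rw [hg, map_zero, map_zero]))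
  obtain ⟨p, hp⟩ := exists_hasTop wt hf0
  obtain ⟨r, hr⟩ := exists_hasTop wt hg0
  have h1 := hp.mul hq wt_inj hr
  have h2 : tL q (tL q f g) = 0 := by rw [← tL_mul hq, ← hf, ← hg, ← map_mul, h, map_zero]
  have h3 := tL_one (q := q) (tL q f g)
  rw [h2] at h3
  rw [← h3] at h1
  exact h1.1 rfl

lemma heis_root {s g : Heis k q} {p : Gam} (hg : Phi hq hq3 g = tM q p) {n : ℕ} (hn : n ≠ 0)
    (h : s ^ n = g ^ n) : ∃ c : k, s = c • g := by
  obtain ⟨f, hf⟩ := Phi_range hq hq3 s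
  have h1 : tL q f ^ n = tM q p ^ n := by rw [← hf, ← hg, ← map_pow, h, map_pow]
  refine ⟨f p, Phi_inj hq hq3 ?_⟩
  rw [map_smul, hg, hf, ← tL_single, ← root_of_monomial hq hn h1]

lemma heis_central {g : Heis k q} {p : Gam} {c : k} (hg : Phi hq hq3 g = c • tM q p)
    (h : ∀ r, tB q p r = tB q r p) : g ∈ Subalgebra.center k (Heis k q) := by
  rw [Subalgebra.mem_center_iff]
  intro b
  obtain ⟨f, hf⟩ := Phi_range hq hq3 b
  apply Phi_inj hq hq3
  rw [map_mul, map_mul, hf, hg, mul_smul_comm, tL_comm hq h, smul_mul_assoc]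

end heis
section anti

open MulOpposite

variable {k : Type*} [Field k] (q : k)

/-- The anti-automorphism of `H_q` swapping `x` and `y`. -/
def anti : Heis k q →ₐ[k] (Heis k q)ᵐᵒᵖ :=
  heisLift q (op (gen q 1)) (op (gen q 0)) (op (gen q 2))
    (by rw [← op_mul, ← op_mul, rel_yz, op_smul])
    (by rw [← op_mul, ← op_mul, rel_zx, op_smul])
    (by rw [← op_mul, ← op_mul, rel_xy, op_add, op_smul, op_pow])

lemma anti_x : anti q (gen q 0) = op (gen q 1) := heisLift_x q

lemma anti_y : anti q (gen q 1) = op (gen q 0) := heisLift_y q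

lemma anti_z : anti q (gen q 2) = op (gen q 2) := heisLift_z q

lemma anti_anti (h : Heis k q) : unop (anti q (unop (anti q h))) = h := by
  induction h using heis_induction with
  | hc c => rw [AlgHom.commutes, MulOpposite.algebraMap_apply, unop_op, AlgHom.commutes, MulOpposite.algebraMap_apply,
      unop_op]
  | hg i =>
    fin_cases i
    · simp [anti_x, anti_y]
    · simp [anti_x, anti_y]
    · simp [anti_z]
  | hm a b ha hb => rw [map_mul, unop_mul, map_mul, unop_mul, ha, hb]
  | ha a b ha hb => rw [map_add, unop_add, map_add, unop_add, ha, hb]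

variable {q}

lemma heis_root_y (hq : q ≠ 0) (hq3 : q ^ 3 ≠ 1) {s : Heis k q} {n : ℕ} (hn : n ≠ 0)
    (h : s ^ n = gen q 1 ^ n) : ∃ c : k, s = c • gen q 1 := by
  have h1 : unop (anti q s) ^ n = gen q 0 ^ n := by
    rw [← unop_pow, ← map_pow, h, map_pow, anti_y, unop_pow, unop_op]
  obtain ⟨c, hc⟩ := heis_root hq hq3 (Phi_x hq hq3) hn h1
  refine ⟨c, ?_⟩
  have h2 := anti_anti q s
  rw [hc, map_smul, anti_x, unop_smul, unop_op] at h2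
  exact h2.symm

lemma anti_central {g : Heis k q} (hg : g ∈ Subalgebra.center k (Heis k q)) :
    unop (anti q g) ∈ Subalgebra.center k (Heis k q) := by
  rw [Subalgebra.mem_center_iff] at hg ⊢
  intro b
  have h := congrArg (fun t => unop (anti q t)) (hg (unop (anti q b)))
  simp only [map_mul, unop_mul, anti_anti] at h
  exact h.symm

end anti

section final

variable {k : Type*} [Field k] {q : k}

lemma tM_pow (hq : q ≠ 0) {p : Gam} (hp : (p.2.2 - p.2.1) * p.1 = 0) (n : ℕ) :
    tM q p ^ n = tM q (n • p) := by
  induction n with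
  | zero => simp [tM_zero]
  | succ n ih =>
    have : tB q p (n • p) = 1 := by
      have e : (p.2.2 - p.2.1) * (n • p).1 = 0 := by
        rw [Prod.smul_fst, mul_smul_comm, hp, smul_zero]
      rw [tB, e, zpow_zero]
    rw [pow_succ', ih, tM_mul hq, this, one_smul, succ_nsmul']

lemma tM_ne (p : Gam) : tM q p ≠ 0 := by
  intro h
  have h1 := tM_single (q := q) p 0 1
  rw [h, tB_zero_right] at h1
  have h2 := congrArg (fun f : Gam →₀ k => f (p + 0)) h1
  simp at h2

lemma ne_of_Phi (hq : q ≠ 0) (hq3 : q ^ 3 ≠ 1) {g : Heis k q} {p : Gam}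
    (h : Phi hq hq3 g = tM q p) : g ≠ 0 := by
  rintro rfl
  exact tM_ne p (by rw [← h, map_zero])

variable (q) in
/-- Diagonal endomorphisms of `H_q`. -/
def dHom (u : kˣ × kˣ) : Heis k q →ₐ[k] Heis k q :=
  heisLift q ((u.1 : k) • gen q 0) (((u.2 ^ 2 * u.1⁻¹ : kˣ) : k) • gen q 1)
    ((u.2 : k) • gen q 2)
    (by rw [smul_mul_smul_comm, smul_mul_smul_comm, rel_zx, smul_smul, smul_smul]; congr 1; ring)
    (by rw [smul_mul_smul_comm, smul_mul_smul_comm, rel_yz, smul_smul, smul_smul]; congr 1; ring)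
    (by
      have e : (u.1 : k) * ((u.2 ^ 2 * u.1⁻¹ : kˣ) : k) = (u.2 : k) ^ 2 := by
        rw [← Units.val_mul, ← Units.val_pow_eq_pow_val]
        congr 1
        rw [mul_comm, mul_assoc, inv_mul_cancel, mul_one]
      rw [smul_mul_smul_comm, smul_mul_smul_comm, rel_xy, smul_pow, mul_comm _ (u.1 : k), e,
        smul_add, smul_comm q])

lemma dHom_x (u : kˣ × kˣ) : dHom q u (gen q 0) = (u.1 : k) • gen q 0 := heisLift_x q

lemma dHom_y (u : kˣ × kˣ) :
    dHom q u (gen q 1) = ((u.2 ^ 2 * u.1⁻¹ : kˣ) : k) • gen q 1 := heisLift_y q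

lemma dHom_z (u : kˣ × kˣ) : dHom q u (gen q 2) = (u.2 : k) • gen q 2 := heisLift_z q

lemma dHom_one : dHom q 1 = AlgHom.id k _ := by
  apply heis_ext <;> simp [dHom_x, dHom_y, dHom_z]

lemma dHom_mul (u v : kˣ × kˣ) : dHom q (u * v) = (dHom q u).comp (dHom q v) := by
  apply heis_ext
  · simp [dHom_x, smul_smul, mul_comm]
  · rw [AlgHom.comp_apply, dHom_y, dHom_y, map_smul, dHom_y, smul_smul, ← Units.val_mul]
    congr 2
    rw [Prod.snd_mul, Prod.fst_mul, mul_inv, mul_pow]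
    exact (mul_mul_mul_comm _ _ _ _).trans (mul_comm _ _)
  · simp [dHom_z, smul_smul, mul_comm]

variable (q) in
/-- Diagonal automorphisms of `H_q`. -/
def dAut : kˣ × kˣ →* (Heis k q ≃ₐ[k] Heis k q) where
  toFun u := AlgEquiv.ofAlgHom (dHom q u) (dHom q u⁻¹)
    (by rw [← dHom_mul, mul_inv_cancel, dHom_one])
    (by rw [← dHom_mul, inv_mul_cancel, dHom_one])
  map_one' := by
    ext h
    exact congrArg (fun f : Heis k q →ₐ[k] Heis k q => f h) dHom_one
  map_mul' u v := by
    ext h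
    exact congrArg (fun f : Heis k q →ₐ[k] Heis k q => f h) (dHom_mul u v)

lemma dAut_apply (u : kˣ × kˣ) (h : Heis k q) : dAut q u h = dHom q u h := rfl

lemma dAut_inj (hq : q ≠ 0) (hq3 : q ^ 3 ≠ 1) : Function.Injective (dAut q) := by
  have hx := ne_of_Phi hq hq3 (Phi_x hq hq3)
  have hz := ne_of_Phi hq hq3 (Phi_z hq hq3)
  intro u v h
  have h0 : dAut q u (gen q 0) = dAut q v (gen q 0) := by rw [h]
  have h2 : dAut q u (gen q 2) = dAut q v (gen q 2) := by rw [h]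
  rw [dAut_apply, dAut_apply, dHom_x, dHom_x] at h0
  rw [dAut_apply, dAut_apply, dHom_z, dHom_z] at h2
  exact Prod.ext (Units.ext (smul_left_injective k hx h0))
    (Units.ext (smul_left_injective k hz h2))

/-- A diagonal automorphism implemented by a nonzero element is ozone. -/
lemma ozone_of_normal (hq : q ≠ 0) (hq3 : q ^ 3 ≠ 1) (u : kˣ × kˣ) {n : Heis k q} (hn : n ≠ 0)
    (h0 : (u.1 : k) • gen q 0 * n = n * gen q 0)
    (h1 : ((u.2 ^ 2 * u.1⁻¹ : kˣ) : k) • gen q 1 * n = n * gen q 1)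
    (h2 : (u.2 : k) • gen q 2 * n = n * gen q 2) :
    dAut q u ∈ ozoneGroup k (Heis k q) := by
  have key : ∀ a, dHom q u a * n = n * a := by
    intro a
    induction a using heis_induction with
    | hc c => rw [AlgHom.commutes, Algebra.commutes]
    | hg i =>
      fin_cases i
      · exact (congrArg (· * n) (dHom_x u)).trans h0
      · exact (congrArg (· * n) (dHom_y u)).trans h1
      · exact (congrArg (· * n) (dHom_z u)).trans h2
    | hm a b ha hb => rw [map_mul, mul_assoc, hb, ← mul_assoc, ha, mul_assoc]
    | ha a b ha hb => rw [map_add, add_mul, mul_add, ha, hb]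
  intro c hc
  rw [Subalgebra.mem_center_iff] at hc
  have h3 : (dHom q u c - c) * n = 0 := by rw [sub_mul, key, hc, sub_self]
  rcases heis_domain hq hq3 h3 with h | h
  · exact sub_eq_zero.1 h
  · exact absurd h hn

lemma ozone_one (hq : q ≠ 0) (hq3 : q ^ 3 ≠ 1) :
    dAut q (Units.mk0 q hq, 1) ∈ ozoneGroup k (Heis k q) := by
  refine ozone_of_normal hq hq3 _ (ne_of_Phi hq hq3 (Phi_z hq hq3)) ?_ ?_ ?_
  · rw [smul_mul_assoc, rel_zx]; rfl
  · rw [smul_mul_assoc, rel_zy hq]; simp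
  · simp

lemma ozone_two (hq : q ≠ 0) (hq3 : q ^ 3 ≠ 1) {m : ℕ} (hm : q ^ (3 * m) = 1) :
    dAut q (1, (Units.mk0 q hq ^ m)⁻¹) ∈ ozoneGroup k (Heis k q) := by
  have hP : Phi hq hq3 (gen q 0 ^ m) = tM q (m, 0, 0) := by
    rw [map_pow, Phi_x, tM_pow hq (by simp)]
    simp
  have hm0 : q ^ m ≠ 0 := pow_ne_zero _ hq
  refine ozone_of_normal hq hq3 _ (ne_of_Phi hq hq3 hP) ?_ ?_ ?_
  · rw [Units.val_one, one_smul, ← pow_succ, ← pow_succ']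
  · apply Phi_inj hq hq3
    have e : (((((1, (Units.mk0 q hq ^ m)⁻¹) : kˣ × kˣ).2) ^ 2 *
        (((1, (Units.mk0 q hq ^ m)⁻¹) : kˣ × kˣ).1)⁻¹ : kˣ) : k) = q ^ m := by
      simp
      field_simp
      rw [← pow_mul, mul_comm m 3, hm]
    have e1 : q ^ m * q ^ (-(m : ℤ)) = 1 := by
      rw [zpow_neg, zpow_natCast, mul_inv_cancel₀ hm0]
    have e2 : q ^ m * q ^ (2 * (m : ℤ)) = 1 := by
      rw [← hm, ← zpow_natCast, ← zpow_natCast, ← zpow_add₀ hq]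
      congr 1
      push_cast
      ring
    rw [e, map_mul, map_mul, map_smul, hP, Phi_y, tL_yf, smul_mul_assoc, add_mul, mul_add,
      smul_mul_assoc, mul_smul_comm, tM_mul hq, tM_mul hq, tM_mul hq, tM_mul hq, smul_add,
      smul_smul, smul_comm (q ^ m), smul_smul (q ^ m)]
    have a1 : tB q (-1, 1, 0) ((m : ℤ), 0, 0) = q ^ (-(m : ℤ)) := by simp [tB]
    have a2 : tB q (-1, 0, 2) ((m : ℤ), 0, 0) = q ^ (2 * (m : ℤ)) := by simp [tB]
    have a3 : ∀ r, tB q ((m : ℤ), 0, 0) r = 1 := by simp [tB]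
    rw [a1, a2, a3, a3, e1, e2, add_comm (-1, 1, 0), add_comm (-1, 0, 2)]
  · have h := qpow (rel_zx q) m
    rw [smul_mul_assoc, h, smul_smul]
    simp [hm0]

lemma ozone_diag {ℓ : ℕ} (hprim : IsPrimitiveRoot q ℓ) (hℓ : ℓ ≠ 0) (hq : q ≠ 0)
    (hq3 : q ^ 3 ≠ 1) {σ : Heis k q ≃ₐ[k] Heis k q} (hσ : σ ∈ ozoneGroup k (Heis k q)) :
    ∃ u : kˣ × kˣ, u.1 ^ ℓ = 1 ∧ u.2 ^ ℓ = 1 ∧ u.2 ^ 3 = 1 ∧ dAut q u = σ := by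
  have hσ' : ∀ z ∈ Subalgebra.center k (Heis k q), σ z = z := hσ
  have hqℓ : ∀ t : ℤ, q ^ (t * ℓ) = 1 := by
    intro t
    rw [mul_comm, zpow_mul, zpow_natCast, hprim.pow_eq_one, one_zpow]
  have hx := ne_of_Phi hq hq3 (Phi_x hq hq3)
  have hz := ne_of_Phi hq hq3 (Phi_z hq hq3)
  have hxP : Phi hq hq3 (gen q 0 ^ ℓ) = tM q (ℓ, 0, 0) := by
    rw [map_pow, Phi_x, tM_pow hq (by simp)]
    simp
  have hzP : Phi hq hq3 (gen q 2 ^ ℓ) = tM q (0, 0, ℓ) := by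
    rw [map_pow, Phi_z, tM_pow hq (by simp)]
    simp
  have cx : gen q 0 ^ ℓ ∈ Subalgebra.center k (Heis k q) := by
    refine heis_central hq hq3 (c := 1) (by rw [one_smul, hxP]) fun r => ?_
    simp [tB, hqℓ]
  have cz : gen q 2 ^ ℓ ∈ Subalgebra.center k (Heis k q) := by
    refine heis_central hq hq3 (c := 1) (by rw [one_smul, hzP]) fun r => ?_
    simp [tB, mul_comm, hqℓ]
  have cy : gen q 1 ^ ℓ ∈ Subalgebra.center k (Heis k q) := by
    have := anti_central cx
    simpa [anti_x] using this
  obtain ⟨α, hα⟩ := heis_root hq hq3 (Phi_x hq hq3) hℓ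
    (s := σ (gen q 0)) (by rw [← map_pow, hσ' _ cx])
  obtain ⟨γ, hγ⟩ := heis_root hq hq3 (Phi_z hq hq3) hℓ
    (s := σ (gen q 2)) (by rw [← map_pow, hσ' _ cz])
  obtain ⟨β, hβ⟩ := heis_root_y hq hq3 hℓ
    (s := σ (gen q 1)) (by rw [← map_pow, hσ' _ cy])
  have eα : α ^ ℓ = 1 := by
    have h := hσ' _ cx
    rw [map_pow, hα, smul_pow] at h
    exact smul_left_injective k (ne_of_Phi hq hq3 hxP) (by simpa using h)
  have eγ : γ ^ ℓ = 1 := by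
    have h := hσ' _ cz
    rw [map_pow, hγ, smul_pow] at h
    exact smul_left_injective k (ne_of_Phi hq hq3 hzP) (by simpa using h)
  have hz2 : Phi hq hq3 (gen q 2 ^ 2) = tM q (0, 0, 2) := by
    rw [map_pow, Phi_z, tM_pow hq (by simp)]
    simp
  have eβ : α * β = γ ^ 2 := by
    have h := congrArg σ (rel_xy q)
    rw [map_mul, map_add, map_smul, map_mul, map_pow, hα, hβ, hγ, smul_mul_smul_comm,
      smul_mul_smul_comm, rel_xy, smul_pow, smul_add, smul_comm q, mul_comm β α] at h
    exact smul_left_injective k (ne_of_Phi hq hq3 hz2) (add_left_cancel h)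
  -- the central element `z w`
  set c : k := (q ^ 3 - 1)⁻¹ with hc
  have hw : Phi hq hq3 (gen q 2 * (gen q 0 * gen q 1 + c • gen q 2 ^ 2)) = tM q (0, 1, 1) := by
    rw [map_mul, map_add, map_smul, hz2, map_mul, Phi_x, Phi_y, Phi_z, tL_yf,
      mul_add (tM q (1, 0, 0)), mul_smul_comm, tM_mul hq, tM_mul hq]
    have a3 : ∀ r, tB q (1, 0, 0) r = 1 := by simp [tB]
    rw [a3, a3, one_smul, one_smul]
    have e : ((1, 0, 0) + (-1, 0, 2) : Gam) = (0, 0, 2) := by simp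
    rw [e, add_assoc, ← add_smul, ← hc, neg_add_cancel, zero_smul, add_zero, tM_mul hq]
    simp [tB]
  have cw : gen q 2 * (gen q 0 * gen q 1 + c • gen q 2 ^ 2) ∈ Subalgebra.center k (Heis k q) := by
    refine heis_central hq hq3 (c := 1) (by rw [one_smul, hw]) fun r => ?_
    simp [tB]
  have eγ3 : γ ^ 3 = 1 := by
    have h := hσ' _ cw
    rw [map_mul, map_add, map_mul, map_smul, map_pow, hα, hβ, hγ, smul_mul_smul_comm, eβ,
      smul_pow, smul_comm c, ← smul_add, smul_mul_smul_comm] at h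
    have h' := smul_left_injective k (ne_of_Phi hq hq3 hw) (h.trans (one_smul k _).symm)
    rw [← h']
    ring
  have α0 : α ≠ 0 := by
    rintro rfl
    rw [zero_pow hℓ] at eα
    exact zero_ne_one eα
  have γ0 : γ ≠ 0 := by
    rintro rfl
    rw [zero_pow hℓ] at eγ
    exact zero_ne_one eγ
  refine ⟨(Units.mk0 α α0, Units.mk0 γ γ0), Units.ext (by simpa using eα),
    Units.ext (by simpa using eγ), Units.ext (by simpa using eγ3), ?_⟩
  have hh : dHom q (Units.mk0 α α0, Units.mk0 γ γ0) = (σ : Heis k q →ₐ[k] Heis k q) := by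
    apply heis_ext
    · rw [dHom_x]; exact hα.symm
    · rw [dHom_y]
      refine Eq.trans ?_ hβ.symm
      congr 1
      simp
      rw [← eβ]
      field_simp
    · rw [dHom_z]; exact hγ.symm
  ext h
  exact congrArg (fun f : Heis k q →ₐ[k] Heis k q => f h) hh

/-- Roots of unity form a cyclic group. -/
def muEquiv {n : ℕ} [NeZero n] {Z : kˣ} (h : IsPrimitiveRoot Z n) :
    rootsOfUnity n k ≃* Multiplicative (ZMod n) :=
  (MulEquiv.subgroupCongr h.zpowers_eq.symm).trans h.zmodEquivZPowers.symm.toMultiplicativeRight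

lemma main_equiv {ℓ d m : ℕ} (hprim : IsPrimitiveRoot q ℓ) (hℓ : ℓ ≠ 0) (hq3 : q ^ 3 ≠ 1)
    (hd : d = Nat.gcd ℓ 3) (hm : ℓ = m * d) :
    Nonempty (↥(ozoneGroup k (Heis k q)) ≃*
        Multiplicative (ZMod ℓ) × Multiplicative (ZMod d)) := by
  have hq : q ≠ 0 := hprim.ne_zero hℓ
  have : NeZero ℓ := ⟨hℓ⟩
  have : NeZero d := ⟨by rintro rfl; simp at hm; exact hℓ hm⟩
  set Q : kˣ := Units.mk0 q hq with hQ
  have hQp : IsPrimitiveRoot Q ℓ := IsPrimitiveRoot.coe_units_iff.1 hprim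
  have hQm : IsPrimitiveRoot (Q ^ m) d := hQp.pow (Nat.pos_of_ne_zero hℓ) hm
  have hG : ozoneGroup k (Heis k q) =
      ((rootsOfUnity ℓ k).prod (rootsOfUnity d k)).map (dAut q) := by
    apply le_antisymm
    · intro σ hσ
      obtain ⟨u, h1, h2, h3, h4⟩ := ozone_diag hprim hℓ hq hq3 hσ
      refine ⟨u, ⟨h1, ?_⟩, h4⟩
      change u.2 ^ d = 1
      rw [hd]
      exact pow_gcd_eq_one.2 ⟨h2, h3⟩
    · rw [Subgroup.map_le_iff_le_comap]
      rintro ⟨a, b⟩ ⟨ha, hb⟩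
      change a ∈ rootsOfUnity ℓ k at ha
      change b ∈ rootsOfUnity d k at hb
      rw [← hQp.zpowers_eq] at ha
      rw [← hQm.zpowers_eq] at hb
      obtain ⟨i, rfl⟩ := ha
      obtain ⟨j, rfl⟩ := hb
      have o1 : (Q, 1) ∈ (ozoneGroup k (Heis k q)).comap (dAut q) := ozone_one hq hq3
      have h3m : q ^ (3 * m) = 1 := by
        rw [hprim.pow_eq_one_iff_dvd, hm, mul_comm]
        exact Nat.mul_dvd_mul_right (hd ▸ Nat.gcd_dvd_right ℓ 3) m
      have o2 : (1, (Q ^ m)⁻¹) ∈ (ozoneGroup k (Heis k q)).comap (dAut q) :=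
        ozone_two hq hq3 h3m
      have e : ((Q ^ i, (Q ^ m) ^ j) : kˣ × kˣ) = (Q, 1) ^ i * (1, (Q ^ m)⁻¹) ^ (-j) := by
        ext <;> simp
      change (Q ^ i, (Q ^ m) ^ j) ∈ _
      rw [e]
      exact Subgroup.mul_mem _ (Subgroup.zpow_mem _ o1 _) (Subgroup.zpow_mem _ o2 _)
  exact ⟨(MulEquiv.subgroupCongr hG).trans
    ((Subgroup.equivMapOfInjective _ _ (dAut_inj hq hq3)).symm.trans
      ((Subgroup.prodEquiv _ _).trans
        (MulEquiv.prodCongr (muEquiv hQp) (muEquiv hQm))))⟩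

theorem main (k : Type*) [Field k] (q : k) (ℓ : ℕ)
    (hq : IsPrimitiveRoot q ℓ) (hℓ2 : 2 ≤ ℓ) (hℓ3 : ℓ ≠ 3) :
    (¬ (3 ∣ ℓ) →
      Nonempty (↥(ozoneGroup k (Heis k q)) ≃* Multiplicative (ZMod ℓ))) ∧
    ((3 ∣ ℓ) →
      Nonempty (↥(ozoneGroup k (Heis k q)) ≃*
        Multiplicative (ZMod ℓ) × Multiplicative (ZMod 3))) := by
  have hq3 : q ^ 3 ≠ 1 := by
    intro h
    rw [hq.pow_eq_one_iff_dvd] at h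
    rcases (Nat.dvd_prime Nat.prime_three).1 h with h | h <;> omega
  have hℓ : ℓ ≠ 0 := by omega
  constructor
  · intro h
    have hg : 1 = Nat.gcd ℓ 3 :=
      (Nat.coprime_iff_gcd_eq_one.1
        ((Nat.Prime.coprime_iff_not_dvd Nat.prime_three).2 h).symm).symm
    obtain ⟨e⟩ := main_equiv (d := 1) (m := ℓ) hq hℓ hq3 hg (by simp)
    have : Unique (Multiplicative (ZMod 1)) :=
      { default := 1, uniq := fun a => Subsingleton.elim (α := ZMod 1) a _ }
    exact ⟨e.trans MulEquiv.prodUnique⟩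
  · intro h
    obtain ⟨m, hm⟩ := h
    exact main_equiv (d := 3) (m := m) hq hℓ hq3 (by rw [hm]; simp) (by rw [hm, mul_comm])

end final

end HeisAux

/-- Let `q ∈ k` be a primitive `ℓ`th root of unity with `ℓ ≥ 2`, `ℓ ≠ 3`.
If `3 ∤ ℓ` then the ozone group of `H_q` is isomorphic to the cyclic group `ℤ/ℓ`;
if `3 ∣ ℓ` then it is isomorphic to `ℤ/ℓ × ℤ/3`. -/
theorem stmt4 (k : Type*) [Field k] [CharZero k] (q : k) (ℓ : ℕ)
    (hq : IsPrimitiveRoot q ℓ) (hℓ2 : 2 ≤ ℓ) (hℓ3 : ℓ ≠ 3) :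
    (¬ (3 ∣ ℓ) →
      Nonempty (↥(ozoneGroup k (Heis k q)) ≃* Multiplicative (ZMod ℓ))) ∧
    ((3 ∣ ℓ) →
      Nonempty (↥(ozoneGroup k (Heis k q)) ≃*
        Multiplicative (ZMod ℓ) × Multiplicative (ZMod 3))) := by
  exact HeisAux.main k q ℓ hq hℓ2 hℓ3
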